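/- arXiv:2411.09830 — 2 statements merged into one kernel-verified Lean document; each statement's English description precedes it below -/
import Mathlib

section
/- For every N > 0 and every real P, the smoothing error of the WTPS objective integrand obeys the quantitative bound |ω̂_{N,c}(P) − ω_c(P)| ≤ (ln 2 / N)·(1 + |c − P|). -/
/-- The generalized WTPS objective integrand with rated power `c`. -/
noncomputable def omegaWTPS (c P : ℝ) : ℝ :=
  min c P - min 0 (c - P) * (c - P)

/-- The logarithmic soft-min approximation of the two-argument minimum. -/
noncomputable def softMin (N a b : ℝ) : ℝ :=
  -(1 / N) * Real.log (Real.exp (-N * a) + Real.exp (-N * b))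

/-- The smoothed WTPS objective integrand. -/
noncomputable def omegaWTPSSmooth (N c P : ℝ) : ℝ :=
  softMin N c P - softMin N 0 (c - P) * (c - P)

theorem softMin_le_min {N : ℝ} (hN : 0 < N) (a b : ℝ) : softMin N a b ≤ min a b := by
  have ha := Real.exp_pos (-N * a)
  have hb := Real.exp_pos (-N * b)
  have h₁ : -N * a ≤ Real.log (Real.exp (-N * a) + Real.exp (-N * b)) :=
    (Real.le_log_iff_exp_le (by positivity)).2 (by linarith)
  have h₂ : -N * b ≤ Real.log (Real.exp (-N * a) + Real.exp (-N * b)) :=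
    (Real.le_log_iff_exp_le (by positivity)).2 (by linarith)
  have h : softMin N a b = -Real.log (Real.exp (-N * a) + Real.exp (-N * b)) / N := by
    rw [softMin]; ring
  rw [h, div_le_iff₀ hN]
  rcases min_choice a b with h | h <;> rw [h] <;> linarith

theorem min_sub_softMin_le {N : ℝ} (hN : 0 < N) (a b : ℝ) :
    min a b - softMin N a b ≤ Real.log 2 / N := by
  have key : Real.log (Real.exp (-N * a) + Real.exp (-N * b)) ≤ Real.log 2 + -N * min a b := by
    rw [Real.log_le_iff_le_exp (by positivity), Real.exp_add, Real.exp_log two_pos]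
    have h₁ : Real.exp (-N * a) ≤ Real.exp (-N * min a b) :=
      Real.exp_le_exp.2 (by nlinarith [min_le_left a b])
    have h₂ : Real.exp (-N * b) ≤ Real.exp (-N * min a b) :=
      Real.exp_le_exp.2 (by nlinarith [min_le_right a b])
    linarith
  have h : min a b - softMin N a b =
      (N * min a b + Real.log (Real.exp (-N * a) + Real.exp (-N * b))) / N := by
    rw [softMin]; field_simp; ring
  rw [h]
  gcongr
  linarith

theorem abs_softMin_sub_min_le {N : ℝ} (hN : 0 < N) (a b : ℝ) :
    |softMin N a b - min a b| ≤ Real.log 2 / N := by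
  rw [abs_sub_comm, abs_of_nonneg (sub_nonneg.2 (softMin_le_min hN a b))]
  exact min_sub_softMin_le hN a b

theorem omegaWTPSSmooth_error_bound (N : ℝ) (hN : 0 < N) (c P : ℝ) :
    |omegaWTPSSmooth N c P - omegaWTPS c P| ≤ Real.log 2 / N * (1 + |c - P|) := by
  have h : omegaWTPSSmooth N c P - omegaWTPS c P =
      (softMin N c P - min c P) - (softMin N 0 (c - P) - min 0 (c - P)) * (c - P) := by
    rw [omegaWTPSSmooth, omegaWTPS]; ring
  calc |omegaWTPSSmooth N c P - omegaWTPS c P|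
      ≤ |softMin N c P - min c P| + |softMin N 0 (c - P) - min 0 (c - P)| * |c - P| := by
        rw [h, ← abs_mul]; exact abs_sub _ _
    _ ≤ Real.log 2 / N + Real.log 2 / N * |c - P| := by
        gcongr <;> exact abs_softMin_sub_min_le hN _ _
    _ = Real.log 2 / N * (1 + |c - P|) := by ring
end

section
/- The hyperbolic-tangent smoothing of the absolute value converges uniformly in x at rate α: for every α > 0 and every real x, |x| − x·tanh(x/α) ≤ α. -/
theorem Real.mul_one_sub_tanh_le_one (y : ℝ) : y * (1 - Real.tanh y) ≤ 1 := by
  have hc := Real.cosh_pos y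
  have hexp : y * Real.exp (-y) ≤ 1 := by
    rw [Real.exp_neg, ← div_eq_mul_inv, div_le_one (Real.exp_pos y)]
    linarith [Real.add_one_le_exp y]
  have htanh : y * (1 - Real.tanh y) = y * Real.exp (-y) / Real.cosh y := by
    rw [Real.tanh_eq_sinh_div_cosh, ← Real.cosh_sub_sinh]
    field_simp
  rw [htanh, div_le_one hc]
  exact hexp.trans (Real.one_le_cosh y)

theorem Real.abs_sub_mul_tanh_le_one (y : ℝ) : |y| - y * Real.tanh y ≤ 1 := by
  rcases abs_cases y with ⟨h, -⟩ | ⟨h, -⟩ <;> rw [h]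
  · linarith [Real.mul_one_sub_tanh_le_one y]
  · have := Real.mul_one_sub_tanh_le_one (-y)
    rw [Real.tanh_neg] at this
    linarith

theorem tanh_smoothing_uniform_rate (α : ℝ) (hα : 0 < α) (x : ℝ) :
    |x| - x * Real.tanh (x / α) ≤ α := by
  obtain ⟨y, rfl⟩ : ∃ y, x = α * y := ⟨x / α, by field_simp⟩
  rw [mul_div_cancel_left₀ y hα.ne', abs_mul, abs_of_pos hα, mul_assoc, ← mul_sub]
  exact mul_le_of_le_one_right hα.le (Real.abs_sub_mul_tanh_le_one y)
end
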